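/- Let n, m, p be positive integers, T_ini ≥ n, T_f ≥ 1, and set L = T_ini + T_f, r = n + mL, k = mL + p·T_ini. Let A ∈ ℝ^{n×n}, B ∈ ℝ^{n×m}, C ∈ ℝ^{p×n}, D ∈ ℝ^{p×m} with trajectory generation matrices Φ_{T_ini} and Φ_L. Assume β > 0 satisfies ‖Φ_{T_ini}·z‖₂ ≥ β·‖z‖₂ for all z ∈ ℝ^{n+m·T_ini}, and α > 0 satisfies ‖Φ_L‖₂ ≤ α. Let V ∈ ℝ^{(m+p)L×r} have orthonormal columns with column space equal to the column space of Φ_L, and let M ∈ ℝ^{k×r} be the submatrix formed by the first mL rows of V (the input rows) together with the next p·T_ini rows (the past output rows), i.e., the first k rows of V. Then ‖M·x‖₂ ≥ (min(1, β)/α)·‖x‖₂ for all x ∈ ℝ^r. Moreover, the same bound holds for M·P for every orthogonal P ∈ ℝ^{r×r}. -/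

import Mathlib

open Matrix BigOperators

/-- Euclidean norm of a real vector. -/
noncomputable def euclNorm {ι : Type*} [Fintype ι] (v : ι → ℝ) : ℝ :=
  Real.sqrt (∑ i, (v i) ^ 2)

/-- Spectral (ℓ²-operator) norm of a real matrix. -/
noncomputable def specNorm {ι κ : Type*} [Fintype ι] [Fintype κ] (M : Matrix ι κ ℝ) : ℝ :=
  sSup {c | ∃ x : κ → ℝ, euclNorm x = 1 ∧ c = euclNorm (M.mulVec x)}


/-- Extended observability matrix `O_L`: `i`-th block row is `C·Aⁱ`. -/
noncomputable def obsMat {n p : ℕ} (A : Matrix (Fin n) (Fin n) ℝ)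
    (C : Matrix (Fin p) (Fin n) ℝ) (L : ℕ) : Matrix (Fin L × Fin p) (Fin n) ℝ :=
  fun ip j => (C * A ^ (ip.1 : ℕ)) ip.2 j

/-- Block lower-triangular Toeplitz matrix `T_L`: `(i,j)` block is `D` if `i = j`,
`C·A^{i−j−1}·B` if `i > j`, and `0` if `i < j`. -/
noncomputable def toepMat {n m p : ℕ} (A : Matrix (Fin n) (Fin n) ℝ)
    (B : Matrix (Fin n) (Fin m) ℝ) (C : Matrix (Fin p) (Fin n) ℝ)
    (D : Matrix (Fin p) (Fin m) ℝ) (L : ℕ) :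
    Matrix (Fin L × Fin p) (Fin L × Fin m) ℝ :=
  fun ip jq =>
    if (ip.1 : ℕ) = (jq.1 : ℕ) then D ip.2 jq.2
    else if (jq.1 : ℕ) < (ip.1 : ℕ) then (C * A ^ ((ip.1 : ℕ) - (jq.1 : ℕ) - 1) * B) ip.2 jq.2
    else 0

/-- Trajectory generation matrix `Φ_L = [[0, I], [O_L, T_L]]`, with rows indexed by the
stacked inputs `(Fin L × Fin m)` followed by the stacked outputs `(Fin L × Fin p)`, and
columns indexed by the initial state `Fin n` followed by the stacked inputs. -/
noncomputable def phiMat {n m p : ℕ} (A : Matrix (Fin n) (Fin n) ℝ)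
    (B : Matrix (Fin n) (Fin m) ℝ) (C : Matrix (Fin p) (Fin n) ℝ)
    (D : Matrix (Fin p) (Fin m) ℝ) (L : ℕ) :
    Matrix ((Fin L × Fin m) ⊕ (Fin L × Fin p)) ((Fin n) ⊕ (Fin L × Fin m)) ℝ :=
  Matrix.fromBlocks 0 1 (obsMat A C L) (toepMat A B C D L)

/-- Row selection embedding picking, out of the stacked rows
`(inputs over [0, T_ini+T_f)) ⊕ (outputs over [0, T_ini+T_f))`, all input rows together with
the past output rows (time indices `< T_ini`): these are the "first `k = mL + p·T_ini` rows". -/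
def pastRows (Tini Tf m p : ℕ) :
    ((Fin (Tini + Tf) × Fin m) ⊕ (Fin Tini × Fin p)) →
      ((Fin (Tini + Tf) × Fin m) ⊕ (Fin (Tini + Tf) × Fin p)) :=
  Sum.map id (fun tp => (Fin.castAdd Tf tp.1, tp.2))

theorem euclNorm_nonneg {ι : Type*} [Fintype ι] (v : ι → ℝ) : 0 ≤ euclNorm v :=
  Real.sqrt_nonneg _

theorem euclNorm_sq {ι : Type*} [Fintype ι] (v : ι → ℝ) : euclNorm v ^ 2 = ∑ i, v i ^ 2 :=
  Real.sq_sqrt (Finset.sum_nonneg fun _ _ => sq_nonneg _)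

theorem euclNorm_eq_norm_toLp {ι : Type*} [Fintype ι] (v : ι → ℝ) :
    euclNorm v = ‖WithLp.toLp 2 v‖ := by
  simp [euclNorm, EuclideanSpace.norm_eq]

theorem euclNorm_smul {ι : Type*} [Fintype ι] (c : ℝ) (v : ι → ℝ) :
    euclNorm (c • v) = |c| * euclNorm v := by
  simp [euclNorm_eq_norm_toLp, norm_smul]

theorem euclNorm_mulVec_of_transpose_mul_self {ι κ : Type*} [Fintype ι] [Fintype κ]
    [DecidableEq κ] {V : Matrix ι κ ℝ} (hV : Vᵀ * V = 1) (x : κ → ℝ) :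
    euclNorm (V *ᵥ x) = euclNorm x := by
  have h : V *ᵥ x ⬝ᵥ V *ᵥ x = x ⬝ᵥ x := by
    rw [Matrix.dotProduct_mulVec, ← Matrix.mulVec_transpose, Matrix.mulVec_mulVec, hV,
      Matrix.one_mulVec]
  simp only [dotProduct, ← sq] at h
  rw [euclNorm, h, euclNorm]

theorem euclNorm_mulVec_le_specNorm {ι κ : Type*} [Fintype ι] [Fintype κ]
    (M : Matrix ι κ ℝ) (z : κ → ℝ) : euclNorm (M *ᵥ z) ≤ specNorm M * euclNorm z := by
  classical
  have hbdd : BddAbove {c | ∃ x : κ → ℝ, euclNorm x = 1 ∧ c = euclNorm (M *ᵥ x)} := by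
    refine ⟨‖(Matrix.toEuclideanLin M).toContinuousLinearMap‖, ?_⟩
    rintro c ⟨x, hx, rfl⟩
    have h := (Matrix.toEuclideanLin M).toContinuousLinearMap.le_opNorm (WithLp.toLp 2 x)
    rw [← euclNorm_eq_norm_toLp x, hx, mul_one] at h
    rw [euclNorm_eq_norm_toLp]
    exact h
  rcases (euclNorm_nonneg z).eq_or_lt with hz | hz
  · have hz0 : z = 0 := by
      rw [euclNorm_eq_norm_toLp, eq_comm, norm_eq_zero] at hz
      simpa using hz
    simp [hz0, euclNorm]
  · have h := le_csSup hbdd ⟨(euclNorm z)⁻¹ • z, by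
      rw [euclNorm_smul, abs_of_pos (inv_pos.2 hz), inv_mul_cancel₀ hz.ne'], rfl⟩
    rw [Matrix.mulVec_smul, euclNorm_smul, abs_of_pos (inv_pos.2 hz), inv_mul_le_iff₀ hz] at h
    rw [mul_comm]
    exact h

/-- The initial state and the inputs at the first `Tini` time steps. -/
def restrictInput {n m Tini Tf : ℕ} (z : Fin n ⊕ (Fin (Tini + Tf) × Fin m) → ℝ) :
    Fin n ⊕ (Fin Tini × Fin m) → ℝ :=
  z ∘ Sum.map id (Prod.map (Fin.castAdd Tf) id)

theorem phiMat_mulVec_inl {n m p L : ℕ} (A : Matrix (Fin n) (Fin n) ℝ)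
    (B : Matrix (Fin n) (Fin m) ℝ) (C : Matrix (Fin p) (Fin n) ℝ) (D : Matrix (Fin p) (Fin m) ℝ)
    (z : Fin n ⊕ (Fin L × Fin m) → ℝ) (i : Fin L × Fin m) :
    (phiMat A B C D L *ᵥ z) (Sum.inl i) = z (Sum.inr i) := by
  simp [phiMat, Matrix.fromBlocks_mulVec]

/-- Outputs are causal: they do not depend on later inputs. -/
theorem phiMat_mulVec_inr_castAdd {n m p Tini Tf : ℕ} (A : Matrix (Fin n) (Fin n) ℝ)
    (B : Matrix (Fin n) (Fin m) ℝ) (C : Matrix (Fin p) (Fin n) ℝ) (D : Matrix (Fin p) (Fin m) ℝ)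
    (z : Fin n ⊕ (Fin (Tini + Tf) × Fin m) → ℝ) (t : Fin Tini) (q : Fin p) :
    (phiMat A B C D (Tini + Tf) *ᵥ z) (Sum.inr (Fin.castAdd Tf t, q)) =
      (phiMat A B C D Tini *ᵥ restrictInput z) (Sum.inr (t, q)) := by
  have h : ∀ j : Fin Tf, ¬ (t : ℕ) = Tini + j ∧ ¬ Tini + (j : ℕ) < t := fun j => by
    have := t.isLt
    omega
  simp [phiMat, restrictInput, Matrix.mulVec, dotProduct, obsMat,
    toepMat, Fintype.sum_prod_type, Fin.sum_univ_add, h]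

theorem euclNorm_sq_phiMat_mulVec {n m p L : ℕ} (A : Matrix (Fin n) (Fin n) ℝ)
    (B : Matrix (Fin n) (Fin m) ℝ) (C : Matrix (Fin p) (Fin n) ℝ) (D : Matrix (Fin p) (Fin m) ℝ)
    (z : Fin n ⊕ (Fin L × Fin m) → ℝ) :
    euclNorm (phiMat A B C D L *ᵥ z) ^ 2 =
      ∑ t, ∑ i, z (Sum.inr (t, i)) ^ 2 +
        ∑ t, ∑ q, (phiMat A B C D L *ᵥ z) (Sum.inr (t, q)) ^ 2 := by
  simp [euclNorm_sq, Fintype.sum_prod_type, phiMat_mulVec_inl]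

theorem euclNorm_sq_eq_restrictInput_add {n m Tini Tf : ℕ}
    (z : Fin n ⊕ (Fin (Tini + Tf) × Fin m) → ℝ) :
    euclNorm z ^ 2 = euclNorm (restrictInput z) ^ 2 +
      ∑ t : Fin Tf, ∑ i, z (Sum.inr (Fin.natAdd Tini t, i)) ^ 2 := by
  simp [euclNorm_sq, restrictInput, Fintype.sum_prod_type, Fin.sum_univ_add, add_assoc]

theorem euclNorm_sq_phiMat_mulVec_comp_pastRows {n m p Tini Tf : ℕ}
    (A : Matrix (Fin n) (Fin n) ℝ) (B : Matrix (Fin n) (Fin m) ℝ)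
    (C : Matrix (Fin p) (Fin n) ℝ) (D : Matrix (Fin p) (Fin m) ℝ)
    (z : Fin n ⊕ (Fin (Tini + Tf) × Fin m) → ℝ) :
    euclNorm ((phiMat A B C D (Tini + Tf) *ᵥ z) ∘ pastRows Tini Tf m p) ^ 2 =
      euclNorm (phiMat A B C D Tini *ᵥ restrictInput z) ^ 2 +
        ∑ t : Fin Tf, ∑ i, z (Sum.inr (Fin.natAdd Tini t, i)) ^ 2 := by
  rw [euclNorm_sq_phiMat_mulVec, euclNorm_sq]
  simp only [pastRows, Fintype.sum_sum_type, Fintype.sum_prod_type, Function.comp_apply,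
    Sum.map_inl, Sum.map_inr, id, phiMat_mulVec_inl, phiMat_mulVec_inr_castAdd,
    Fin.sum_univ_add, restrictInput, Prod.map_apply]
  ring

/-- Past outputs together with all inputs determine the initial state and the inputs, with
gain at least `min 1 β`. -/
theorem min_mul_euclNorm_le_euclNorm_phiMat_mulVec_comp_pastRows {n m p Tini Tf : ℕ}
    (A : Matrix (Fin n) (Fin n) ℝ) (B : Matrix (Fin n) (Fin m) ℝ)
    (C : Matrix (Fin p) (Fin n) ℝ) (D : Matrix (Fin p) (Fin m) ℝ) {β : ℝ} (hβ : 0 ≤ β)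
    (hβbound : ∀ z : (Fin n ⊕ (Fin Tini × Fin m)) → ℝ,
      β * euclNorm z ≤ euclNorm (phiMat A B C D Tini *ᵥ z))
    (z : Fin n ⊕ (Fin (Tini + Tf) × Fin m) → ℝ) :
    min 1 β * euclNorm z ≤
      euclNorm ((phiMat A B C D (Tini + Tf) *ᵥ z) ∘ pastRows Tini Tf m p) := by
  have hc : 0 ≤ min 1 β := le_min zero_le_one hβ
  refine (sq_le_sq₀ (mul_nonneg hc (euclNorm_nonneg z)) (euclNorm_nonneg _)).1 ?_
  rw [mul_pow, euclNorm_sq_phiMat_mulVec_comp_pastRows, euclNorm_sq_eq_restrictInput_add, mul_add,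
    ← mul_pow]
  refine add_le_add ?_ (mul_le_of_le_one_left (by positivity) (pow_le_one₀ hc (min_le_left 1 β)))
  have h := euclNorm_nonneg (restrictInput z)
  exact pow_le_pow_left₀ (mul_nonneg hc h)
    ((mul_le_mul_of_nonneg_right (min_le_right 1 β) h).trans (hβbound _)) 2

/-- Lemma 2 of the paper: lower bound on the smallest singular value of the
predictor matrix `M` in terms of the degree of observability `β` and the gain `α`; the bound
is representation-free. -/
theorem predictor_matrix_sigma_min_bound
    (n m p Tini Tf : ℕ) (hn : 0 < n) (hm : 0 < m) (hp : 0 < p)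
    (hTini : n ≤ Tini) (hTf : 1 ≤ Tf)
    (A : Matrix (Fin n) (Fin n) ℝ) (B : Matrix (Fin n) (Fin m) ℝ)
    (C : Matrix (Fin p) (Fin n) ℝ) (D : Matrix (Fin p) (Fin m) ℝ)
    (β α : ℝ) (hβ : 0 < β)
    (hβbound : ∀ z : (Fin n ⊕ (Fin Tini × Fin m)) → ℝ,
      β * euclNorm z ≤ euclNorm ((phiMat A B C D Tini).mulVec z))
    (hα : 0 < α) (hαbound : specNorm (phiMat A B C D (Tini + Tf)) ≤ α)
    (V : Matrix ((Fin (Tini + Tf) × Fin m) ⊕ (Fin (Tini + Tf) × Fin p))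
          (Fin (n + m * (Tini + Tf))) ℝ)
    (hVorth : Vᵀ * V = 1)
    (hVrange : LinearMap.range V.mulVecLin =
      LinearMap.range (phiMat A B C D (Tini + Tf)).mulVecLin) :
    (∀ x : Fin (n + m * (Tini + Tf)) → ℝ,
      (min 1 β / α) * euclNorm x ≤
        euclNorm ((V.submatrix (pastRows Tini Tf m p) id).mulVec x)) ∧
    ∀ P : Matrix (Fin (n + m * (Tini + Tf))) (Fin (n + m * (Tini + Tf))) ℝ, Pᵀ * P = 1 →
      ∀ x : Fin (n + m * (Tini + Tf)) → ℝ,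
        (min 1 β / α) * euclNorm x ≤
          euclNorm ((V.submatrix (pastRows Tini Tf m p) id * P).mulVec x) := by
  have key : ∀ x : Fin (n + m * (Tini + Tf)) → ℝ,
      (min 1 β / α) * euclNorm x ≤
        euclNorm ((V.submatrix (pastRows Tini Tf m p) id).mulVec x) := by
    intro x
    obtain ⟨z, hz⟩ : V *ᵥ x ∈ LinearMap.range (phiMat A B C D (Tini + Tf)).mulVecLin :=
      hVrange ▸ ⟨x, rfl⟩
    rw [Matrix.mulVecLin_apply] at hz
    have hM : (V.submatrix (pastRows Tini Tf m p) id) *ᵥ x =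
        (phiMat A B C D (Tini + Tf) *ᵥ z) ∘ pastRows Tini Tf m p := by
      rw [hz]
      rfl
    have hxz : euclNorm x ≤ α * euclNorm z := by
      rw [← euclNorm_mulVec_of_transpose_mul_self hVorth, ← hz]
      exact (euclNorm_mulVec_le_specNorm _ z).trans
        (mul_le_mul_of_nonneg_right hαbound (euclNorm_nonneg z))
    rw [hM]
    calc min 1 β / α * euclNorm x ≤ min 1 β / α * (α * euclNorm z) := by gcongr
      _ = min 1 β * euclNorm z := by field_simp
      _ ≤ _ := min_mul_euclNorm_le_euclNorm_phiMat_mulVec_comp_pastRows A B C D hβ.le hβbound z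
  refine ⟨key, fun P hP x => ?_⟩
  rw [← Matrix.mulVec_mulVec, ← euclNorm_mulVec_of_transpose_mul_self hP x]
  exact key _
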